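/- Let r be a positive integer with r ≡ 3 (mod 4). Then there is no hyperbolic avsp: there do not exist an F-vector space U of dimension r+2, a hyperplane H of U, a nondegenerate quadratic form Q on H of Witt defect 0, a generator Π of Q, and a hyperbolic avsp for (U, H, Q, Π). -/

import Mathlib

open Module Submodule

section Defs

variable {F : Type*} [Field F] {V : Type*} [AddCommGroup V] [Module F V]

/-- A subspace is totally singular if the quadratic form vanishes on it. -/
def IsTotallySingular (Q : QuadraticForm F V) (W : Submodule F V) : Prop :=
  ∀ x ∈ W, Q x = 0

/-- The Witt index: maximal dimension of a totally singular subspace. -/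
noncomputable def wittIndex (Q : QuadraticForm F V) : ℕ :=
  sSup {n : ℕ | ∃ W : Submodule F V, IsTotallySingular Q W ∧ Module.finrank F ↥W = n}

/-- Nondegeneracy: the only singular vector orthogonal to everything is `0`. -/
def QuadNondeg (Q : QuadraticForm F V) : Prop :=
  ∀ v : V, Q v = 0 → (∀ x : V, QuadraticMap.polar Q v x = 0) → v = 0

/-- A generator: totally singular subspace of dimension the Witt index. -/
def IsGenerator (Q : QuadraticForm F V) (G : Submodule F V) : Prop :=
  IsTotallySingular Q G ∧ Module.finrank F ↥G = wittIndex Q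

/-- A spread of `Q`. -/
def IsSpread (Q : QuadraticForm F V) (S : Set (Submodule F V)) : Prop :=
  (∀ G ∈ S, IsGenerator Q G) ∧
  (∀ G ∈ S, ∀ G' ∈ S, G ≠ G' → G ⊓ G' = ⊥) ∧
  (∀ v : V, Q v = 0 → ∃ G ∈ S, v ∈ G)

/-- The perp of a vector with respect to the polar form of `Q`. -/
def vecPerp (Q : QuadraticForm F V) (u : V) : Submodule F V :=
  LinearMap.ker (QuadraticMap.polarBilin Q u)

/-- The perp of a subspace with respect to the polar form of `Q`. -/
def subPerp (Q : QuadraticForm F V) (G : Submodule F V) : Submodule F V :=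
  ⨅ g ∈ G, vecPerp Q g

/-- Hyperbolic (e = 0), parabolic (e = 1) or elliptic (e = 2) affine vector space
partition for `(U, H, Q, Pgen)`. -/
def IsAvsp [Fintype F] (e r : ℕ) {U : Type*} [AddCommGroup U] [Module F U]
    (H : Submodule F U) (Q : QuadraticForm F ↥H) (Pgen : Submodule F ↥H)
    (P : Set (Submodule F U)) : Prop :=
  P.ncard = Fintype.card F ^ ((r + e + 1) / 2) ∧
  (∀ S ∈ P, Module.finrank F ↥S = (r + 3 - e) / 2 ∧ ¬ S ≤ H) ∧
  (∀ L : Submodule F U, Module.finrank F ↥L = 1 → ¬ L ≤ H → ∃! S, S ∈ P ∧ L ≤ S) ∧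
  (∀ S ∈ P, IsGenerator Q (S.comap H.subtype) ∧ S.comap H.subtype ⊓ Pgen = ⊥) ∧
  (∀ S ∈ P, ∀ T ∈ P, S ≠ T → S.comap H.subtype ≠ T.comap H.subtype) ∧
  (∀ S ∈ P, ∀ T ∈ P, S ≠ T → Module.finrank F ↥(S ⊓ T) ≤ 1) ∧
  (∀ S ∈ P, ∀ T ∈ P, S ≠ T →
    Module.finrank F ↥(S.comap H.subtype ⊓ T.comap H.subtype) = 1 →
      QuadNondeg (Q.comp ((S ⊔ T).comap H.subtype).subtype) ∧
      Module.finrank F ↥((S ⊔ T).comap H.subtype) =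
        2 * wittIndex (Q.comp ((S ⊔ T).comap H.subtype).subtype))

end Defs

/-- The radical of an alternating bilinear form has the same parity of dimension as the space. -/
theorem LinearMap.IsAlt.even_finrank_add_finrank_ker {K V : Type*} [Field K] [AddCommGroup V]
    [Module K V] [FiniteDimensional K V] {B : V →ₗ[K] V →ₗ[K] K} (hB : B.IsAlt) :
    Even (finrank K V + finrank K (LinearMap.ker B)) := by
  induction hn : finrank K V using Nat.strong_induction_on generalizing V with
  | _ n ih =>
  subst hn
  by_cases h0 : B = 0
  · rw [h0, LinearMap.ker_zero, finrank_top]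
    exact Even.add_self _
  obtain ⟨x, y, hxy⟩ : ∃ x y, B x y ≠ 0 := by
    by_contra! h
    exact h0 (LinearMap.ext₂ h)
  have hneg : ∀ u v, B u v = -B v u := fun u v => (hB.neg v u).symm
  set f : V →ₗ[K] K × K := (B x).prod (B y) with hf
  set W := LinearMap.ker f with hW
  have hmem : ∀ w, w ∈ W ↔ B x w = 0 ∧ B y w = 0 := fun w => by simp [hW, hf]
  have hyx : B y x ≠ 0 := by rw [hneg]; exact neg_ne_zero.mpr hxy
  have hfsurj : LinearMap.range f = ⊤ := by
    rw [LinearMap.range_eq_top]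
    rintro ⟨a, b⟩
    refine ⟨(b / B y x) • x + (a / B x y) • y, ?_⟩
    simp [hf, hB.self_eq_zero, hxy, hyx]
  have hdim : finrank K W + 2 = finrank K V := by
    have := f.finrank_range_add_finrank_ker
    rw [hfsurj, finrank_top, Module.finrank_prod, finrank_self] at this
    rw [← this, add_comm]
  have hker : (LinearMap.ker (B.domRestrict₁₂ W W)).map W.subtype = LinearMap.ker B := by
    ext k
    simp only [Submodule.mem_map, LinearMap.mem_ker, Submodule.subtype_apply]
    constructor
    · rintro ⟨⟨k, hk⟩, h, rfl⟩
      obtain ⟨hk1, hk2⟩ := (hmem k).1 hk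
      ext v
      obtain ⟨u, hu⟩ : ∃ u : W, v = (u : V) + (B y v / B y x) • x + (B x v / B x y) • y := by
        refine ⟨⟨v - (B y v / B y x) • x - (B x v / B x y) • y, ?_⟩, by simp [sub_sub, add_assoc]⟩
        rw [hmem]
        simp [hB.self_eq_zero, hxy, hyx]
      have h1 : B k u = 0 := LinearMap.congr_fun h u
      rw [hu]
      simp [h1, hneg k x, hneg k y, hk1, hk2]
    · intro h
      refine ⟨⟨k, (hmem k).2 ?_⟩, ?_, rfl⟩
      · rw [hneg x, hneg y, h]
        simp
      · ext w
        exact LinearMap.congr_fun h w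
  have halt : (B.domRestrict₁₂ W W).IsAlt := fun w => hB w
  have hW_even := ih _ (by omega) halt rfl
  rw [← hker, LinearEquiv.finrank_eq (Submodule.equivSubtypeMap W _).symm, ← hdim]
  rw [Nat.even_iff] at hW_even ⊢
  omega

/-- The polar form vanishes on a totally singular subspace. -/
theorem IsTotallySingular.polar_eq_zero {F V : Type*} [Field F] [AddCommGroup V] [Module F V]
    {Q : QuadraticForm F V} {W : Submodule F V} (hW : IsTotallySingular Q W) {x y : V}
    (hx : x ∈ W) (hy : y ∈ W) : QuadraticMap.polar Q x y = 0 := by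
  simp [QuadraticMap.polar, hW _ hx, hW _ hy, hW _ (W.add_mem hx hy)]

/-- Two totally singular subspaces with a common totally singular complement in a nondegenerate
quadratic space meet in a subspace whose dimension has the same parity as theirs. -/
theorem even_finrank_add_finrank_inf_of_isCompl {F V : Type*} [Field F] [AddCommGroup V]
    [Module F V] [FiniteDimensional F V] {Q : QuadraticForm F V} (hQ : QuadNondeg Q)
    {A B C : Submodule F V} (hA : IsTotallySingular Q A) (hB : IsTotallySingular Q B)
    (hC : IsTotallySingular Q C) (hAC : IsCompl A C) (hBC : IsCompl B C) :
    Even (finrank F A + finrank F ↥(A ⊓ B)) := by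
  let p : V →ₗ[F] V := C.projection B hBC.symm
  have hpC : ∀ v, p v ∈ C := Submodule.projection_apply_mem hBC.symm
  have hpB : ∀ v, v - p v ∈ B := Submodule.sub_projection_mem hBC.symm
  set β : A →ₗ[F] A →ₗ[F] F := ((QuadraticMap.polarBilin Q).comp p).domRestrict₁₂ A A with hβ
  have hβ_apply : ∀ a a' : A, β a a' = QuadraticMap.polar Q (p a) a' := fun a a' => rfl
  have halt : β.IsAlt := fun a => by
    have h : QuadraticMap.polar Q (p a) (a - p a) = 0 := by
      rw [QuadraticMap.polar, add_sub_cancel, hA _ a.2, hC _ (hpC a), hB _ (hpB a)]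
      simp
    rwa [QuadraticMap.polar_sub_right, hC.polar_eq_zero (hpC a) (hpC a), sub_zero] at h
  have hker : (LinearMap.ker β).map A.subtype = A ⊓ B := by
    ext v
    simp only [Submodule.mem_map, LinearMap.mem_ker, Submodule.subtype_apply, Submodule.mem_inf]
    constructor
    · rintro ⟨a, ha, rfl⟩
      refine ⟨a.2, ?_⟩
      refine (Submodule.projection_apply_eq_zero_iff hBC.symm).1 ?_
      change p a = 0
      refine hQ _ (hC _ (hpC a)) fun x => ?_
      obtain ⟨a', c, ha', hc, rfl⟩ := Submodule.codisjoint_iff_exists_add_eq.1 hAC.codisjoint x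
      rw [QuadraticMap.polar_add_right, hC.polar_eq_zero (hpC a) hc, add_zero]
      exact LinearMap.congr_fun ha ⟨a', ha'⟩
    · rintro ⟨hvA, hvB⟩
      refine ⟨⟨v, hvA⟩, ?_, rfl⟩
      ext a'
      have : p v = 0 := (Submodule.projection_apply_eq_zero_iff hBC.symm).2 hvB
      simp [hβ_apply, this]
  rw [← hker, LinearEquiv.finrank_eq (Submodule.equivSubtypeMap A _).symm]
  exact halt.even_finrank_add_finrank_ker

theorem no_hyperbolic_avsp_of_r_mod_four_eq_three {F : Type*} [Field F] [Fintype F]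
    (r : ℕ) (hr : r % 4 = 3)
    (U : Type*) [AddCommGroup U] [Module F U] [FiniteDimensional F U]
    (hU : Module.finrank F U = r + 2)
    (H : Submodule F U) (hH : Module.finrank F ↥H = r + 1)
    (Q : QuadraticForm F ↥H) (hQnd : QuadNondeg Q)
    (hdef : Module.finrank F ↥H = 2 * wittIndex Q)
    (Pgen : Submodule F ↥H) (hPgen : IsGenerator Q Pgen) :
    ¬ ∃ P : Set (Submodule F U), IsAvsp 0 r H Q Pgen P := by
  rintro ⟨P, hcard, hdim, hcover, hgen, -, hinf, -⟩
  have hcompl : ∀ S ∈ P, IsCompl (S.comap H.subtype) Pgen := fun S hS => by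
    refine (Submodule.isCompl_iff_disjoint _ _ ?_).2 (disjoint_iff.2 (hgen S hS).2)
    rw [(hgen S hS).1.2, hPgen.2]
    omega
  have hone : 1 < P.ncard := by
    rw [hcard]
    exact Nat.one_lt_pow (by omega) Fintype.one_lt_card
  obtain ⟨S, hS, T, hT, hST⟩ := (Set.one_lt_ncard (Set.finite_of_ncard_pos (by omega))).1 hone
  have h1 : finrank F ↥(S ⊓ T) = 1 := by
    have h2 := Submodule.finrank_sup_add_finrank_inf_eq S T
    have h3 := Submodule.finrank_le (S ⊔ T)
    have h4 := (hdim S hS).1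
    have h5 := (hdim T hT).1
    have h6 := hinf S hS T hT hST
    omega
  have hle : S ⊓ T ≤ H := by
    by_contra hle
    exact hST ((hcover _ h1 hle).unique ⟨hS, inf_le_left⟩ ⟨hT, inf_le_right⟩)
  have h7 : finrank F ↥(S.comap H.subtype ⊓ T.comap H.subtype) = 1 := by
    rw [← Submodule.comap_inf, (Submodule.comapSubtypeEquivOfLe hle).finrank_eq, h1]
  have h8 := even_finrank_add_finrank_inf_of_isCompl hQnd (hgen S hS).1.1 (hgen T hT).1.1
    hPgen.1 (hcompl S hS) (hcompl T hT)
  rw [h7, (hgen S hS).1.2, Nat.even_iff] at h8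
  omega
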